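/- arXiv:1208.2635 — 2 statements merged into one kernel-verified Lean document; each statement's English description precedes it below -/
import Mathlib

section
/- Let ε > 0 and c ≥ 1, and take λ = ((1+ε)/ε)·(23 + 5c)·log p. Then with probability at least 1 − 2p^(−c) over the Gaussian noise z: Π(J) < Π(J⋆) for every J ⊆ {1,…,p} with |J| > (1+ε)·s⋆, and moreover Σ_{J : |J| > (1+ε)s⋆} Π(J) ≤ 4·p^(−c)·Π(J⋆). -/
open MeasureTheory ProbabilityTheory Finset
open scoped Classical ENNReal

/-- The exponential moment of the square of a standard Gaussian is finite at `1 / 4`. -/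
lemma lintegral_exp_sq_div_four_gaussianReal_le :
    ∫⁻ x, ENNReal.ofReal (Real.exp (x ^ 2 / 4)) ∂(gaussianReal 0 1) ≤ 2 := by
  rw [gaussianReal_of_var_ne_zero _ one_ne_zero,
    lintegral_withDensity_eq_lintegral_mul _ (measurable_gaussianPDF 0 1) (by fun_prop)]
  have h : ∀ x : ℝ, (gaussianPDF 0 1 * fun x ↦ ENNReal.ofReal (Real.exp (x ^ 2 / 4))) x
      = ENNReal.ofReal (√2) * gaussianPDF 0 2 x := by
    intro x
    simp only [Pi.mul_apply, gaussianPDF]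
    rw [← ENNReal.ofReal_mul (gaussianPDFReal_nonneg _ _ _), ← ENNReal.ofReal_mul (by positivity)]
    congr 1
    simp only [gaussianPDFReal, NNReal.coe_one, NNReal.coe_ofNat, sub_zero, mul_one]
    rw [mul_assoc, ← Real.exp_add, mul_comm (2 * Real.pi) 2, Real.sqrt_mul (by norm_num) (2 * _),
      mul_inv, ← mul_assoc, ← mul_assoc, mul_inv_cancel₀ (by positivity), one_mul]
    ring_nf
  simp_rw [h]
  rw [lintegral_const_mul _ (measurable_gaussianPDF 0 2), lintegral_gaussianPDF_eq_one _ two_ne_zero,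
    mul_one]
  refine (ENNReal.ofReal_le_ofReal (?_ : √2 ≤ 2)).trans (by simp)
  rw [Real.sqrt_le_left (by norm_num)]
  norm_num

lemma lintegral_exp_norm_sq_div_four_stdGaussian_le (E : Type*) [NormedAddCommGroup E]
    [InnerProductSpace ℝ E] [FiniteDimensional ℝ E] [MeasurableSpace E] [BorelSpace E] :
    ∫⁻ x, ENNReal.ofReal (Real.exp (‖x‖ ^ 2 / 4)) ∂(stdGaussian E) ≤ 2 ^ Module.finrank ℝ E := by
  rw [stdGaussian, lintegral_map (by fun_prop) (by fun_prop)]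
  have h : ∀ x : Fin (Module.finrank ℝ E) → ℝ,
      ENNReal.ofReal (Real.exp (‖∑ i, x i • stdOrthonormalBasis ℝ E i‖ ^ 2 / 4))
        = ∏ i, ENNReal.ofReal (Real.exp ((x i) ^ 2 / 4)) := by
    intro x
    rw [← ENNReal.ofReal_prod_of_nonneg (fun _ _ ↦ (Real.exp_pos _).le), ← Real.exp_sum,
      ← Finset.sum_div, ← real_inner_self_eq_norm_sq,
      (stdOrthonormalBasis ℝ E).orthonormal.inner_sum]
    simp [sq]
  simp_rw [h]
  rw [lintegral_prod_eq_prod_lintegral_of_indepFun Finset.univ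
    (fun i (x : Fin (Module.finrank ℝ E) → ℝ) ↦ ENNReal.ofReal (Real.exp ((x i) ^ 2 / 4)))
    (iIndepFun_pi (X := fun _ (x : ℝ) ↦ ENNReal.ofReal (Real.exp (x ^ 2 / 4)))
      (fun _ ↦ by fun_prop)) (fun _ ↦ by fun_prop)]
  calc _ ≤ ∏ _i : Fin (Module.finrank ℝ E), (2 : ℝ≥0∞) := by
        refine Finset.prod_le_prod' fun i _ ↦ ?_
        have := (measurePreserving_eval (fun _ : Fin (Module.finrank ℝ E) ↦ gaussianReal 0 1) i)
        rw [this.lintegral_comp (f := fun x ↦ ENNReal.ofReal (Real.exp (x ^ 2 / 4))) (by fun_prop)]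
        exact lintegral_exp_sq_div_four_gaussianReal_le
    _ = _ := by simp

lemma stdGaussian_map_orthogonalProjectionOnto {E : Type*} [NormedAddCommGroup E]
    [InnerProductSpace ℝ E] [FiniteDimensional ℝ E] [MeasurableSpace E] [BorelSpace E]
    (D : Submodule ℝ E) :
    (stdGaussian E).map D.orthogonalProjectionOnto = stdGaussian D := by
  apply Measure.ext_of_charFun
  ext t
  have h := charFun_stdGaussian (t : E)
  rw [charFun_apply] at h
  rw [charFun_stdGaussian, charFun_apply, integral_map (by fun_prop) (by fun_prop)]
  simpa using h

/-- Chernoff bound for the squared norm of the projection of a Gaussian vector. -/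
lemma measure_norm_sq_orthogonalProjectionOnto_ge_le {n : ℕ} {σ : ℝ} (hσ : 0 < σ)
    (D : Submodule ℝ (EuclideanSpace ℝ (Fin n))) (a : ℝ) :
    Measure.pi (fun _ : Fin n ↦ gaussianReal 0 (Real.toNNReal (σ ^ 2)))
      {z | a ≤ ‖D.orthogonalProjectionOnto (WithLp.toLp 2 z)‖ ^ 2 / (2 * σ ^ 2)}
      ≤ ENNReal.ofReal (2 ^ Module.finrank ℝ D * Real.exp (-a / 2)) := by
  have hscale : Measure.pi (fun _ : Fin n ↦ gaussianReal 0 (Real.toNNReal (σ ^ 2)))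
      = (Measure.pi (fun _ : Fin n ↦ gaussianReal 0 1)).map (fun z i ↦ σ * z i) := by
    rw [Measure.pi_map_pi (fun _ ↦ by fun_prop)]
    congr 1
    ext1 i
    rw [gaussianReal_map_const_mul]
    congr 1
    · simp
    · ext; simp [sq_nonneg]
  have hset : MeasurableSet {x : D | a ≤ ‖x‖ ^ 2 / 2} :=
    measurableSet_le measurable_const (by fun_prop)
  rw [hscale, Measure.map_apply (by fun_prop) (measurableSet_le measurable_const (by fun_prop))]
  have hpre : (fun (z : Fin n → ℝ) i ↦ σ * z i) ⁻¹'
        {z | a ≤ ‖D.orthogonalProjectionOnto (WithLp.toLp 2 z)‖ ^ 2 / (2 * σ ^ 2)}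
      = WithLp.toLp 2 ⁻¹' (D.orthogonalProjectionOnto ⁻¹' {x : D | a ≤ ‖x‖ ^ 2 / 2}) := by
    ext z
    have : WithLp.toLp 2 (fun i ↦ σ * z i) = σ • WithLp.toLp 2 z := rfl
    simp only [Set.mem_preimage, Set.mem_ofPred_eq, this, map_smul, norm_smul, mul_pow,
      Real.norm_eq_abs, sq_abs]
    rw [mul_comm 2 (σ ^ 2), mul_div_mul_left _ _ (by positivity)]
  rw [hpre, ← Measure.map_apply (by fun_prop)
    (D.orthogonalProjectionOnto.continuous.measurable hset), map_pi_eq_stdGaussian,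
    ← Measure.map_apply D.orthogonalProjectionOnto.continuous.measurable hset,
    stdGaussian_map_orthogonalProjectionOnto]
  have hM := mul_meas_ge_le_lintegral (μ := stdGaussian D)
    (f := fun x ↦ ENNReal.ofReal (Real.exp (‖x‖ ^ 2 / 4))) (by fun_prop)
    (ENNReal.ofReal (Real.exp (a / 2)))
  have hsub : {x : D | a ≤ ‖x‖ ^ 2 / 2} ⊆ {x : D | ENNReal.ofReal (Real.exp (a / 2)) ≤
      ENNReal.ofReal (Real.exp (‖x‖ ^ 2 / 4))} := by
    intro x hx
    simp only [Set.mem_ofPred_eq] at hx ⊢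
    gcongr ENNReal.ofReal (Real.exp ?_)
    linarith
  have hle := (mul_le_mul_right (measure_mono hsub) _).trans
    (hM.trans (lintegral_exp_norm_sq_div_four_stdGaussian_le D))
  rw [neg_div, Real.exp_neg, ← div_eq_mul_inv, ENNReal.ofReal_div_of_pos (Real.exp_pos _),
    ENNReal.le_div_iff_mul_le (by simp [Real.exp_pos]) (by simp), mul_comm,
    ENNReal.ofReal_pow (by norm_num)]
  simpa using hle

open Submodule in
/-- Residual comparison between a least-squares fit on `A` and an arbitrary fit on `B`. -/
lemma exists_submodule_norm_residual_sq_le {ι E : Type*} [NormedAddCommGroup E]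
    [InnerProductSpace ℝ E] [FiniteDimensional ℝ E] (x : ι → E) (A B : Finset ι) :
    ∃ D : Submodule ℝ E, Module.finrank ℝ D ≤ B.card ∧
      ∀ z m a b : E, m ∈ span ℝ (x '' A) → a ∈ span ℝ (x '' A) → b ∈ span ℝ (x '' B) →
        (∀ j ∈ A, inner ℝ (m + z - a) (x j) = 0) →
        ‖m + z - a‖ ^ 2 - ‖m + z - b‖ ^ 2 ≤ ‖D.orthogonalProjectionOnto z‖ ^ 2 := by
  set W := span ℝ (x '' A) with hW
  refine ⟨(span ℝ (x '' B)).map (Wᗮ.starProjection : E →ₗ[ℝ] E), ?_, ?_⟩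
  · refine (finrank_map_le _ _).trans ?_
    rw [← Finset.coe_image]
    exact (finrank_span_finset_le_card _).trans Finset.card_image_le
  set D := (span ℝ (x '' B)).map (Wᗮ.starProjection : E →ₗ[ℝ] E) with hD
  intro z m a b hm ha hb hort
  have hDW : D ≤ Wᗮ := by
    rintro _ ⟨v, -, rfl⟩
    exact Wᗮ.starProjection_apply_mem v
  have hWD : W ≤ Dᗮ := (le_orthogonal_orthogonal W).trans (orthogonal_le hDW)
  have hr : m + z - a ∈ Wᗮ := by
    rw [hW, mem_orthogonal]
    intro u hu
    induction hu using span_induction with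
    | mem u h =>
      obtain ⟨j, hj, rfl⟩ := h
      rw [real_inner_comm]
      exact hort j hj
    | zero => simp
    | add u v _ _ hu hv => rw [inner_add_left, hu, hv, add_zero]
    | smul c u _ hu => rw [real_inner_smul_left, hu, mul_zero]
  set r := m + z - a with hr_def
  have hproj : D.orthogonalProjectionOnto z = D.orthogonalProjectionOnto r := by
    have : D.orthogonalProjectionOnto (m - a) = 0 :=
      orthogonalProjectionOnto_apply_of_mem_orthogonal
        (hWD (W.sub_mem hm ha))
    rw [show r = z + (m - a) by rw [hr_def]; abel, map_add, this, add_zero]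
  have hsplit := Wᗮ.norm_sq_eq_add_norm_sq_starProjection (m + z - b)
  have h1 : Wᗮ.starProjection (m + z - b) = r - Wᗮ.starProjection b := by
    have ha0 : Wᗮ.starProjection a = 0 := by
      rw [starProjection_apply, orthogonalProjectionOnto_apply_of_mem_orthogonal
        (le_orthogonal_orthogonal W ha)]
      rfl
    rw [show m + z - b = r + a - b by rw [hr_def]; abel, map_sub, map_add, ha0, add_zero,
      starProjection_eq_self_iff.mpr hr]
  have hbD : Wᗮ.starProjection b ∈ D := ⟨b, hb, rfl⟩
  have hsplit2 := Dᗮ.norm_sq_eq_add_norm_sq_starProjection (r - Wᗮ.starProjection b)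
  have h2 : Dᗮ.starProjection (r - Wᗮ.starProjection b) = Dᗮ.starProjection r := by
    rw [map_sub, starProjection_apply Dᗮ (Wᗮ.starProjection b),
      orthogonalProjectionOnto_apply_of_mem_orthogonal
        (le_orthogonal_orthogonal D hbD)]
    simp
  have hsplit3 := D.norm_sq_eq_add_norm_sq_starProjection r
  rw [h1] at hsplit
  rw [h2] at hsplit2
  have h4 : ‖D.starProjection r‖ = ‖D.orthogonalProjectionOnto r‖ := rfl
  rw [hproj, ← h4]
  nlinarith [sq_nonneg ‖Wᗮᗮ.starProjection (m + z - b)‖,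
    sq_nonneg ‖Dᗮᗮ.starProjection (r - Wᗮ.starProjection b)‖]

lemma sum_nonempty_rpow_card_le {p : ℕ} (hp : 2 ≤ p) {c : ℝ} (hc : 0 ≤ c) :
    ∑ J : Finset (Fin p) with J.Nonempty, (p : ℝ) ^ (-(2 + c) * (J.card : ℝ))
      ≤ (p : ℝ) ^ (-c) := by
  have hp0 : (0 : ℝ) < p := by positivity
  have hp2 : (2 : ℝ) ≤ p := by exact_mod_cast hp
  set q : ℝ := (p : ℝ) ^ (-(2 + c)) with hq
  have hq0 : 0 ≤ q := by positivity
  have hsum : ∑ J : Finset (Fin p) with J.Nonempty, (p : ℝ) ^ (-(2 + c) * (J.card : ℝ))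
      = (q + 1) ^ p - 1 := by
    have h := Finset.sum_pow_mul_eq_add_pow q 1 (Finset.univ : Finset (Fin p))
    simp only [one_pow, mul_one, Finset.powerset_univ, Finset.card_univ, Fintype.card_fin] at h
    have h0 : (univ.filter fun J : Finset (Fin p) ↦ J.Nonempty) = univ.erase ∅ := by
      ext J
      simp [Finset.nonempty_iff_ne_empty]
    rw [h0, ← h, eq_sub_iff_add_eq, ← Finset.sum_erase_add _ _ (Finset.mem_univ (∅ : Finset (Fin p))),
      card_empty, pow_zero]
    congr 1
    exact sum_congr rfl fun J _ ↦ by rw [hq, ← Real.rpow_mul_natCast hp0.le]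
  have hpq : (p : ℝ) * (p * q) = (p : ℝ) ^ (-c) := by
    rw [hq, ← mul_assoc, ← sq, ← Real.rpow_natCast, ← Real.rpow_add hp0]
    congr 1
    push_cast
    ring
  have hle1 : (p : ℝ) ^ (-c) ≤ 1 := Real.rpow_le_one_of_one_le_of_nonpos (by linarith) (by linarith)
  have hx0 : 0 ≤ p * q := by positivity
  have hexp := Real.abs_exp_sub_one_le (x := p * q) (by rw [abs_of_nonneg hx0]; nlinarith)
  rw [abs_of_nonneg hx0] at hexp
  have hpow : (q + 1) ^ p ≤ Real.exp (p * q) := by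
    rw [Real.exp_nat_mul]
    gcongr
    exact Real.add_one_le_exp q
  rw [hsum]
  nlinarith [le_abs_self (Real.exp (p * q) - 1)]

lemma toLp_mulVec_mem_span {n p : ℕ} (X : Matrix (Fin n) (Fin p) ℝ) {J : Finset (Fin p)}
    {cf : Fin p → ℝ} (hcf : ∀ j ∉ J, cf j = 0) :
    WithLp.toLp 2 (X.mulVec cf) ∈
      Submodule.span ℝ ((fun j ↦ (WithLp.toLp 2 fun i ↦ X i j : EuclideanSpace ℝ (Fin n))) '' J) := by
  have h : (WithLp.toLp 2 (X.mulVec cf) : EuclideanSpace ℝ (Fin n))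
      = ∑ j ∈ J, cf j • WithLp.toLp 2 fun i ↦ X i j := by
    ext i
    rw [PiLp.toLp_apply, Matrix.mulVec_eq_sum, Finset.sum_subset (Finset.subset_univ J)]
    · simp [mul_comm]
    · intro j _ hj
      simp [hcf j hj]
  rw [h]
  exact Submodule.sum_mem _ fun j hj ↦
    Submodule.smul_mem _ _ (Submodule.subset_span ⟨j, hj, rfl⟩)

/-- Comparison of the unnormalized posterior weights, given a bound on the residuals. -/
lemma weight_le_rpow_mul_weight {p s t : ℕ} (hp : 2 ≤ p) (hsp : s ≤ p) (htp : t ≤ p)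
    {ε c lam a b : ℝ} (hε : 0 < ε) (hc : 1 ≤ c)
    (hlam : lam = ((1 + ε) / ε) * (23 + 5 * c) * Real.log p)
    (hst : (1 + ε) * (s : ℝ) < (t : ℝ)) (hab : a - b ≤ (20 + 4 * c) * t * Real.log p) :
    ((p.choose t : ℝ))⁻¹ * Real.exp (-(lam * t)) * Real.exp (-b)
      ≤ (p : ℝ) ^ (-(2 + c) * (t : ℝ)) *
        (((p.choose s : ℝ))⁻¹ * Real.exp (-(lam * s)) * Real.exp (-a)) := by
  have hp0 : (0 : ℝ) < p := by positivity
  have hL : 0 ≤ Real.log p := Real.log_natCast_nonneg p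
  have hs0 : (0 : ℝ) ≤ s := by positivity
  have ht : ((p.choose t : ℝ))⁻¹ ≤ 1 :=
    inv_le_one_of_one_le₀ (by exact_mod_cast Nat.choose_pos htp)
  have hs : Real.exp (-(s * Real.log p)) ≤ ((p.choose s : ℝ))⁻¹ := by
    rw [Real.exp_neg, Real.exp_nat_mul, Real.exp_log hp0]
    refine inv_anti₀ (by exact_mod_cast Nat.choose_pos hsp) ?_
    exact_mod_cast Nat.choose_le_pow p s
  have hgap : (23 + 5 * c) * t * Real.log p ≤ lam * t - lam * s := by
    have h1 : (t : ℝ) ≤ (1 + ε) / ε * (t - s) := by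
      rw [div_mul_eq_mul_div, le_div_iff₀ hε]
      linarith
    have h2 : 0 ≤ (23 + 5 * c) * Real.log p := by positivity
    rw [hlam]
    linarith [mul_le_mul_of_nonneg_right h1 h2]
  have hst' : (s : ℝ) * Real.log p ≤ t * Real.log p :=
    mul_le_mul_of_nonneg_right (by nlinarith) hL
  calc ((p.choose t : ℝ))⁻¹ * Real.exp (-(lam * t)) * Real.exp (-b)
      ≤ 1 * Real.exp (-(lam * t)) * Real.exp (-b) := by gcongr
    _ = Real.exp (-(lam * t) - b) := by rw [one_mul, ← Real.exp_add]; rfl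
    _ ≤ Real.exp (Real.log p * (-(2 + c) * t) + (-(s * Real.log p) + -(lam * s) + -a)) := by
        rw [Real.exp_le_exp]
        linarith
    _ = (p : ℝ) ^ (-(2 + c) * (t : ℝ)) *
        (Real.exp (-(s * Real.log p)) * Real.exp (-(lam * s)) * Real.exp (-a)) := by
        rw [Real.rpow_def_of_pos hp0, Real.exp_add, Real.exp_add, Real.exp_add]
    _ ≤ _ := by gcongr

/-- Simultaneous control of all projections of a Gaussian vector on subspaces `D J` with
`dim (D J) ≤ |J|`. -/
lemma measure_exists_norm_sq_orthogonalProjectionOnto_ge_le {n p : ℕ} (hp : 2 ≤ p) {σ : ℝ}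
    (hσ : 0 < σ) {c : ℝ} (hc : 1 ≤ c)
    (D : Finset (Fin p) → Submodule ℝ (EuclideanSpace ℝ (Fin n)))
    (hD : ∀ J, Module.finrank ℝ (D J) ≤ J.card) :
    Measure.pi (fun _ : Fin n ↦ gaussianReal 0 (Real.toNNReal (σ ^ 2)))
      (⋃ J ∈ univ.filter (fun J : Finset (Fin p) ↦ J.Nonempty),
        {z | (20 + 4 * c) * J.card * Real.log p
          ≤ ‖(D J).orthogonalProjectionOnto (WithLp.toLp 2 z)‖ ^ 2 / (2 * σ ^ 2)})
      ≤ ENNReal.ofReal ((p : ℝ) ^ (-c)) := by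
  have hp0 : (0 : ℝ) < p := by positivity
  have hp2 : (2 : ℝ) ≤ p := by exact_mod_cast hp
  refine (measure_biUnion_finset_le _ _).trans ((Finset.sum_le_sum
    (g := fun J ↦ ENNReal.ofReal ((p : ℝ) ^ (-(2 + c) * (J.card : ℝ)))) fun J _ ↦
    (measure_norm_sq_orthogonalProjectionOnto_ge_le hσ (D J) _).trans
      (ENNReal.ofReal_le_ofReal ?_)).trans ?_)
  · calc (2 : ℝ) ^ Module.finrank ℝ (D J)
          * Real.exp (-((20 + 4 * c) * J.card * Real.log p) / 2)
        ≤ (p : ℝ) ^ J.card * Real.exp (-((20 + 4 * c) * J.card * Real.log p) / 2) := by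
          gcongr
          exact (pow_le_pow_right₀ (by norm_num) (hD J)).trans (by gcongr)
      _ = (p : ℝ) ^ (-(9 + 2 * c) * (J.card : ℝ)) := by
          rw [← Real.rpow_natCast, Real.rpow_def_of_pos hp0, Real.rpow_def_of_pos hp0,
            ← Real.exp_add]
          congr 1
          ring
      _ ≤ (p : ℝ) ^ (-(2 + c) * (J.card : ℝ)) := by
          refine Real.rpow_le_rpow_of_exponent_le (by linarith) ?_
          exact mul_le_mul_of_nonneg_right (by linarith) (by positivity)
  · rw [← ENNReal.ofReal_sum_of_nonneg (fun _ _ ↦ by positivity)]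
    exact ENNReal.ofReal_le_ofReal (sum_nonempty_rpow_card_le hp (by linarith))

theorem stmt2
    (n p : ℕ) (hn : 1 ≤ n) (hnp : n ≤ p) (hp2 : 2 ≤ p)
    (X : Matrix (Fin n) (Fin p) ℝ)
    (hX : ∀ j, Real.sqrt (∑ i, (X i j)^2) = Real.sqrt n)
    (σ : ℝ) (hσ : 0 < σ)
    (βs : Fin p → ℝ) (sstar : ℕ) (hs1 : 1 ≤ sstar)
    (Jstar : Finset (Fin p)) (hJstar : Jstar = Finset.univ.filter (fun j => βs j ≠ 0))
    (hcard : Jstar.card = sstar)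
    (P : Finset (Fin p) → (Fin n → ℝ) → (Fin n → ℝ))
    (hP : ∀ (J : Finset (Fin p)) (v : Fin n → ℝ),
        (∃ cf : Fin p → ℝ, (∀ j ∉ J, cf j = 0) ∧ P J v = X.mulVec cf)
        ∧ ∀ j ∈ J, (∑ i, (v i - P J v i) * X i j) = 0)
    (μ : Measure (Fin n → ℝ))
    (hμ : μ = Measure.pi (fun _ : Fin n => gaussianReal 0 (Real.toNNReal (σ^2))))
    (hminimal : ∀ b : Fin p → ℝ, X.mulVec b = X.mulVec βs →
        sstar ≤ (Finset.univ.filter (fun j => b j ≠ 0)).card)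
    (y : (Fin n → ℝ) → Fin n → ℝ)
    (hy : ∀ z i, y z i = X.mulVec βs i + z i)
    (sbar : ℕ) (hsbar1 : sstar ≤ sbar) (hsbar2 : sbar ≤ p)
    (lam : ℝ)
    (w Post : (Fin n → ℝ) → Finset (Fin p) → ℝ)
    (hw : ∀ z J, w z J = if J.card ≤ sbar then
        ((p.choose J.card : ℝ))⁻¹ * Real.exp (-(lam * (J.card : ℝ)))
          * Real.exp (-(∑ i, (y z i - P J (y z) i)^2) / (2 * σ^2)) else 0)
    (hPost : ∀ z J, Post z J = w z J / ∑ J' : Finset (Fin p), w z J')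
    (ε c : ℝ) (hε : 0 < ε) (hc : 1 ≤ c)
    (hlam : lam = ((1 + ε) / ε) * (23 + 5 * c) * Real.log p)
    :
    ENNReal.ofReal (1 - 2 * (p : ℝ) ^ (-c)) ≤
      μ {z |
        (∀ J : Finset (Fin p), (1 + ε) * (sstar : ℝ) < (J.card : ℝ) →
            Post z J < Post z Jstar) ∧
        ∑ J ∈ Finset.univ.filter
            (fun J : Finset (Fin p) => (1 + ε) * (sstar : ℝ) < (J.card : ℝ)), Post z J
          ≤ 4 * (p : ℝ) ^ (-c) * Post z Jstar} := by
  have hp0 : (0 : ℝ) < p := by positivity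
  have hp2' : (2 : ℝ) ≤ p := by exact_mod_cast hp2
  set x : Fin p → EuclideanSpace ℝ (Fin n) := fun j ↦ WithLp.toLp 2 fun i ↦ X i j with hx
  choose D hDcard hD using exists_submodule_norm_residual_sq_le x Jstar
  have hbad := measure_exists_norm_sq_orthogonalProjectionOnto_ge_le hp2 hσ hc D hDcard
  rw [← hμ] at hbad
  set bad := ⋃ J ∈ univ.filter (fun J : Finset (Fin p) ↦ J.Nonempty),
    {z : Fin n → ℝ | (20 + 4 * c) * J.card * Real.log p
      ≤ ‖(D J).orthogonalProjectionOnto (WithLp.toLp 2 z)‖ ^ 2 / (2 * σ ^ 2)} with hbad_def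
  have : IsProbabilityMeasure μ := by rw [hμ]; infer_instance
  have hres : ∀ z J, ∑ i, (y z i - P Jstar (y z) i) ^ 2 - ∑ i, (y z i - P J (y z) i) ^ 2
      ≤ ‖(D J).orthogonalProjectionOnto (WithLp.toLp 2 z)‖ ^ 2 := by
    intro z J
    obtain ⟨⟨cs, hcs, hPs⟩, hort⟩ := hP Jstar (y z)
    obtain ⟨⟨cJ, hcJ, hPJ⟩, -⟩ := hP J (y z)
    have h := hD J (WithLp.toLp 2 z) (WithLp.toLp 2 (X.mulVec βs))
      (WithLp.toLp 2 (P Jstar (y z))) (WithLp.toLp 2 (P J (y z)))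
      (toLp_mulVec_mem_span X fun j hj ↦ by simpa [hJstar] using hj)
      (by rw [hPs]; exact toLp_mulVec_mem_span X hcs)
      (by rw [hPJ]; exact toLp_mulVec_mem_span X hcJ)
      (fun j hj ↦ by
        rw [← hort j hj, PiLp.inner_apply]
        refine sum_congr rfl fun i _ ↦ ?_
        simp [hx, hy, mul_comm])
    simpa [EuclideanSpace.real_norm_sq_eq, hy] using h
  have hwpos : ∀ z, 0 < w z Jstar := by
    intro z
    rw [hw, if_pos (hcard ▸ hsbar1)]
    have : 0 < p.choose Jstar.card := Nat.choose_pos (by omega)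
    positivity
  have hwnn : ∀ z J, 0 ≤ w z J := by
    intro z J
    rw [hw]
    split_ifs <;> positivity
  have hkey : ∀ z ∉ bad, ∀ J : Finset (Fin p), (1 + ε) * (sstar : ℝ) < (J.card : ℝ) →
      J.Nonempty ∧ w z J ≤ (p : ℝ) ^ (-(2 + c) * (J.card : ℝ)) * w z Jstar := by
    intro z hz J hJ
    have hJne : J.Nonempty := by
      rw [← Finset.card_pos]
      have : (0 : ℝ) < J.card := lt_of_le_of_lt (by positivity) hJ
      exact_mod_cast this
    refine ⟨hJne, ?_⟩
    by_cases hJs : J.card ≤ sbar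
    · simp only [hbad_def, Set.mem_iUnion, Set.mem_ofPred_eq, mem_filter, mem_univ, true_and,
        exists_prop, not_exists, not_and, not_le] at hz
      rw [hw z J, hw z Jstar, if_pos hJs, if_pos (hcard ▸ hsbar1), hcard, neg_div, neg_div]
      refine weight_le_rpow_mul_weight hp2 (hsbar1.trans hsbar2) (hJs.trans hsbar2) hε hc hlam hJ ?_
      rw [← sub_div]
      refine le_trans ?_ (hz J hJne).le
      gcongr
      exact hres z J
    · rw [hw z J, if_neg hJs]
      exact mul_nonneg (by positivity) (hwpos z).le
  have hsub : (Set.univ : Set (Fin n → ℝ)) ⊆ bad ∪ {z |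
      (∀ J : Finset (Fin p), (1 + ε) * (sstar : ℝ) < (J.card : ℝ) → Post z J < Post z Jstar) ∧
      ∑ J ∈ Finset.univ.filter
          (fun J : Finset (Fin p) => (1 + ε) * (sstar : ℝ) < (J.card : ℝ)), Post z J
        ≤ 4 * (p : ℝ) ^ (-c) * Post z Jstar} := by
    intro z _
    by_cases hz : z ∈ bad
    · exact Or.inl hz
    refine Or.inr ⟨fun J hJ ↦ ?_, ?_⟩
    · obtain ⟨hJne, hle⟩ := hkey z hz J hJ
      have hS : 0 < ∑ J' : Finset (Fin p), w z J' :=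
        sum_pos' (fun J' _ ↦ hwnn z J') ⟨Jstar, mem_univ _, hwpos z⟩
      rw [hPost, hPost]
      refine div_lt_div_of_pos_right (hle.trans_lt (mul_lt_of_lt_one_left (hwpos z) ?_)) hS
      refine Real.rpow_lt_one_of_one_lt_of_neg (by linarith) ?_
      have : (0 : ℝ) < J.card := by exact_mod_cast hJne.card_pos
      nlinarith
    · have hS : 0 ≤ ∑ J' : Finset (Fin p), w z J' := sum_nonneg fun J' _ ↦ hwnn z J'
      simp only [hPost]
      rw [← sum_div, ← mul_div_assoc]
      refine div_le_div_of_nonneg_right ?_ hS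
      have hsum := sum_nonempty_rpow_card_le hp2 (zero_le_one.trans hc)
      calc _ ≤ ∑ J ∈ Finset.univ.filter
              (fun J : Finset (Fin p) => (1 + ε) * (sstar : ℝ) < (J.card : ℝ)),
              (p : ℝ) ^ (-(2 + c) * (J.card : ℝ)) * w z Jstar :=
            sum_le_sum fun J hJ ↦ (hkey z hz J (mem_filter.mp hJ).2).2
        _ ≤ ∑ J : Finset (Fin p) with J.Nonempty,
              (p : ℝ) ^ (-(2 + c) * (J.card : ℝ)) * w z Jstar := by
            refine sum_le_sum_of_subset_of_nonneg (fun J hJ ↦ ?_)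
              fun J _ _ ↦ mul_nonneg (by positivity) (hwpos z).le
            exact mem_filter.mpr ⟨mem_univ _, (hkey z hz J (mem_filter.mp hJ).2).1⟩
        _ ≤ (p : ℝ) ^ (-c) * w z Jstar := by
            rw [← sum_mul]
            exact mul_le_mul_of_nonneg_right hsum (hwpos z).le
        _ ≤ 4 * (p : ℝ) ^ (-c) * w z Jstar := by
            refine mul_le_mul_of_nonneg_right ?_ (hwpos z).le
            linarith [Real.rpow_pos_of_pos hp0 (-c)]
  have hone := (measure_mono (μ := μ) hsub).trans (measure_union_le _ _)
  rw [measure_univ] at hone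
  rw [ENNReal.ofReal_sub _ (by positivity), ENNReal.ofReal_one, tsub_le_iff_left]
  refine hone.trans (add_le_add_left (hbad.trans (ENNReal.ofReal_le_ofReal ?_)) _)
  linarith [Real.rpow_pos_of_pos hp0 (-c)]
end

section
/- Fix 0 < ε ≤ 1/2 and c ≥ 1, take λ = ((1+ε)/ε)·(23 + 5c)·log p, and assume ν_{(2+ε)s⋆} > 0. Then with probability at least 1 − 3p^(−c) over the Gaussian noise z, any maximizer Ĵ_map of Π satisfies ‖β̂_{Ĵ_map} − β⋆‖₂ ≤ σ·√(8 s⋆ λ/(n·ν_{(2+ε)s⋆}²)). -/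
open MeasureTheory ProbabilityTheory Finset
open scoped Classical ENNReal

/-- The moment generating function of the square of a centred Gaussian of variance `v`, evaluated
at `1 / (4 v)`. -/
theorem lintegral_exp_sq_gaussianReal {v : NNReal} (hv : v ≠ 0) :
    ∫⁻ x, ENNReal.ofReal (Real.exp (x ^ 2 / (4 * v))) ∂(gaussianReal 0 v)
      = ENNReal.ofReal (Real.sqrt 2) := by
  have hv' : (0 : ℝ) < v := by positivity
  rw [gaussianReal_of_var_ne_zero _ hv,
    lintegral_withDensity_eq_lintegral_mul _ (measurable_gaussianPDF 0 v) (by fun_prop)]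
  have key : ∀ x : ℝ, (gaussianPDF 0 v * fun x : ℝ =>
      ENNReal.ofReal (Real.exp (x ^ 2 / (4 * v)))) x
      = ENNReal.ofReal (Real.sqrt 2) * gaussianPDF 0 (2 * v) x := by
    intro x
    simp only [Pi.mul_apply, gaussianPDF]
    rw [← ENNReal.ofReal_mul (gaussianPDFReal_nonneg _ _ _),
      ← ENNReal.ofReal_mul (Real.sqrt_nonneg _)]
    congr 1
    simp only [gaussianPDFReal, NNReal.coe_mul, NNReal.coe_ofNat, sub_zero]
    rw [mul_assoc, ← Real.exp_add,
      show 2 * Real.pi * (2 * (v : ℝ)) = 2 * (2 * Real.pi * v) by ring,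
      Real.sqrt_mul (by norm_num : (0 : ℝ) ≤ 2) (2 * Real.pi * v), mul_inv, ← mul_assoc, ← mul_assoc,
      mul_inv_cancel₀ (by positivity), one_mul]
    congr 2
    field_simp
    ring
  simp_rw [key]
  rw [lintegral_const_mul _ (measurable_gaussianPDF _ _),
    lintegral_gaussianPDF_eq_one _ (by positivity), mul_one]

/-- The characteristic function of a centred isotropic Gaussian vector. -/
theorem charFun_pi_gaussianReal {ι : Type*} [Fintype ι] (v : NNReal) (t : EuclideanSpace ℝ ι) :
    charFun ((Measure.pi fun _ : ι => gaussianReal 0 v).map (WithLp.toLp 2)) t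
      = Complex.exp (-(v * ‖t‖ ^ 2 / 2)) := by
  simp_rw [charFun_pi, charFun_gaussianReal, ← Complex.exp_sum, ← Complex.ofReal_pow,
    EuclideanSpace.real_norm_sq_eq]
  simp [Finset.sum_div, Finset.mul_sum]

/-- The coordinates of a centred isotropic Gaussian vector along an orthonormal family are again
independent with the same variance. -/
theorem map_inner_pi_gaussianReal {ι κ : Type*} [Fintype ι] [Fintype κ] (v : NNReal)
    {e : ι → EuclideanSpace ℝ κ} (he : Orthonormal ℝ e) :
    (Measure.pi fun _ : κ => gaussianReal 0 v).map
        (fun z => WithLp.toLp 2 fun l => inner ℝ (e l) (WithLp.toLp 2 z))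
      = (Measure.pi fun _ : ι => gaussianReal 0 v).map (WithLp.toLp 2) := by
  have hm : Measurable fun z : κ → ℝ =>
      (WithLp.toLp 2 fun l => inner ℝ (e l) (WithLp.toLp 2 z) : EuclideanSpace ℝ ι) := by
    fun_prop
  have : IsProbabilityMeasure ((Measure.pi fun _ : κ => gaussianReal 0 v).map
        (fun z => (WithLp.toLp 2 fun l => inner ℝ (e l) (WithLp.toLp 2 z) :
          EuclideanSpace ℝ ι))) := Measure.isProbabilityMeasure_map hm.aemeasurable
  have : IsProbabilityMeasure ((Measure.pi fun _ : ι => gaussianReal 0 v).map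
      (WithLp.toLp 2 : (ι → ℝ) → EuclideanSpace ℝ ι)) :=
    Measure.isProbabilityMeasure_map (by fun_prop)
  apply Measure.ext_of_charFun (E := EuclideanSpace ℝ ι)
  ext t
  rw [charFun_pi_gaussianReal]
  have hn : ‖∑ l, t l • e l‖ ^ 2 = ‖t‖ ^ 2 := by
    rw [← real_inner_self_eq_norm_sq, he.inner_sum, EuclideanSpace.real_norm_sq_eq]
    simp [sq]
  have h2 := charFun_pi_gaussianReal v (∑ l, t l • e l)
  rw [← Complex.ofReal_pow, hn, Complex.ofReal_pow] at h2
  rw [← h2, charFun_apply, charFun_apply, integral_map hm.aemeasurable (by fun_prop),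
    integral_map (by fun_prop) (by fun_prop)]
  congr 1
  ext z
  congr 3
  simp only [PiLp.inner_apply, inner_sum, inner_smul_right, RCLike.inner_apply, conj_trivial]
  refine Finset.sum_congr rfl fun l _ => ?_
  simp only [Finset.mul_sum]
  exact Finset.sum_congr rfl fun i _ => by ring

/-- The exponential moment of a chi-square variable, realized as the squared norm of a projection
of an isotropic Gaussian vector. -/
theorem lintegral_exp_norm_sq_starProjection {κ : Type*} [Fintype κ] {v : NNReal} (hv : v ≠ 0)
    (V : Submodule ℝ (EuclideanSpace ℝ κ)) :
    ∫⁻ z, ENNReal.ofReal (Real.exp (‖V.starProjection (WithLp.toLp 2 z)‖ ^ 2 / (4 * v)))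
        ∂(Measure.pi fun _ : κ => gaussianReal 0 v)
      = ENNReal.ofReal (Real.sqrt 2) ^ Module.finrank ℝ V := by
  set b := stdOrthonormalBasis ℝ V
  have he : Orthonormal ℝ fun l => (b l : EuclideanSpace ℝ κ) :=
    b.orthonormal.comp_linearIsometry V.subtypeₗᵢ
  have hnorm : ∀ z : κ → ℝ, ‖V.starProjection (WithLp.toLp 2 z)‖ ^ 2
      = ‖(WithLp.toLp 2 fun l => inner ℝ (b l : EuclideanSpace ℝ κ) (WithLp.toLp 2 z) :
          EuclideanSpace ℝ (Fin (Module.finrank ℝ V)))‖ ^ 2 := by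
    intro z
    rw [Submodule.starProjection_apply, ← Submodule.coe_norm, ← b.sum_sq_norm_inner_right,
      EuclideanSpace.real_norm_sq_eq]
    simp
  simp_rw [hnorm]
  rw [← lintegral_map (μ := Measure.pi fun _ : κ => gaussianReal 0 v)
      (f := fun x : EuclideanSpace ℝ (Fin (Module.finrank ℝ V)) =>
        ENNReal.ofReal (Real.exp (‖x‖ ^ 2 / (4 * v)))) (by fun_prop) (by fun_prop),
    map_inner_pi_gaussianReal v he, lintegral_map (by fun_prop) (by fun_prop)]
  simp_rw [EuclideanSpace.real_norm_sq_eq, Finset.sum_div, Real.exp_sum]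
  simp_rw [ENNReal.ofReal_prod_of_nonneg fun i _ => (Real.exp_pos _).le]
  rw [lintegral_prod_eq_prod_lintegral_of_indepFun Finset.univ
    (fun i (x : Fin (Module.finrank ℝ V) → ℝ) => ENNReal.ofReal (Real.exp (x i ^ 2 / (4 * v))))
    (iIndepFun_pi (X := fun _ (x : ℝ) => ENNReal.ofReal (Real.exp (x ^ 2 / (4 * v))))
      fun i => by fun_prop) (fun i => by fun_prop)]
  have h1 : ∀ i : Fin (Module.finrank ℝ V),
      ∫⁻ x, ENNReal.ofReal (Real.exp (x i ^ 2 / (4 * v)))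
        ∂(Measure.pi fun _ : Fin (Module.finrank ℝ V) => gaussianReal 0 v)
      = ENNReal.ofReal (Real.sqrt 2) := by
    intro i
    rw [← lintegral_exp_sq_gaussianReal hv]
    exact (measurePreserving_eval (fun _ : Fin (Module.finrank ℝ V) => gaussianReal 0 v) i)
      |>.lintegral_comp (f := fun x => ENNReal.ofReal (Real.exp (x ^ 2 / (4 * v)))) (by fun_prop)
  simp [h1]

/-- Chernoff bound for the squared norm of a projected isotropic Gaussian vector. -/
theorem measure_lt_norm_sq_starProjection_le {κ : Type*} [Fintype κ] {v : NNReal} (hv : v ≠ 0)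
    (V : Submodule ℝ (EuclideanSpace ℝ κ)) (t : ℝ) :
    (Measure.pi fun _ : κ => gaussianReal 0 v)
        {z | 4 * v * t < ‖V.starProjection (WithLp.toLp 2 z)‖ ^ 2}
      ≤ ENNReal.ofReal (Real.exp (-t) * Real.sqrt 2 ^ Module.finrank ℝ V) := by
  have hv' : (0 : ℝ) < v := by positivity
  have h := meas_ge_le_lintegral_div (μ := Measure.pi fun _ : κ => gaussianReal 0 v)
    (f := fun z => ENNReal.ofReal
      (Real.exp (‖V.starProjection (WithLp.toLp 2 z)‖ ^ 2 / (4 * v)))) (by fun_prop)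
    (ε := ENNReal.ofReal (Real.exp t)) (by simp [Real.exp_pos]) (by simp)
  rw [lintegral_exp_norm_sq_starProjection hv V, ← ENNReal.ofReal_pow (Real.sqrt_nonneg _),
    ← ENNReal.ofReal_div_of_pos (Real.exp_pos _)] at h
  rw [Real.exp_neg, mul_comm (Real.exp t)⁻¹, ← div_eq_mul_inv]
  refine (measure_mono fun z hz => ?_).trans h
  simp only [Set.mem_ofPred_eq] at hz ⊢
  apply ENNReal.ofReal_le_ofReal
  rw [Real.exp_le_exp, le_div_iff₀ (by positivity)]
  linarith

/-- Simultaneous control of the Gaussian noise projected onto a family of subspaces indexed by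
subsets, when the subspace indexed by `J` has dimension at most `#J`. -/
theorem measure_exists_lt_norm_sq_starProjection_le {κ : Type*} [Fintype κ] {v : NNReal}
    (hv : v ≠ 0) {p : ℕ} (hp : 2 ≤ p) (V : Finset (Fin p) → Submodule ℝ (EuclideanSpace ℝ κ))
    (hV : ∀ J, Module.finrank ℝ (V J) ≤ J.card) {c : ℝ} (hc : 0 ≤ c) :
    (Measure.pi fun _ : κ => gaussianReal 0 v)
        {z | ∃ J, v * ((4 * c + 6) * Real.log p * J.card)
          < ‖(V J).starProjection (WithLp.toLp 2 z)‖ ^ 2}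
      ≤ ENNReal.ofReal (2 * (p : ℝ) ^ (-c)) := by
  have hp0 : (0 : ℝ) < p := by positivity
  have hp2 : (2 : ℝ) ≤ p := by exact_mod_cast hp
  set a : ℝ := (p : ℝ) ^ (-(c + 1)) with ha
  have ha0 : 0 ≤ a := by positivity
  have hpa : p * a = (p : ℝ) ^ (-c) := by
    rw [ha, neg_add, Real.rpow_add hp0, Real.rpow_neg_one]
    field_simp
  have hone : ∀ J : Finset (Fin p), (Measure.pi fun _ : κ => gaussianReal 0 v)
        {z | v * ((4 * c + 6) * Real.log p * J.card)
          < ‖(V J).starProjection (WithLp.toLp 2 z)‖ ^ 2} ≤ ENNReal.ofReal (a ^ J.card) := by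
    intro J
    have h := measure_lt_norm_sq_starProjection_le hv (V J)
      ((c + 3 / 2) * Real.log p * J.card)
    rw [show 4 * (v : ℝ) * ((c + 3 / 2) * Real.log p * J.card)
      = v * ((4 * c + 6) * Real.log p * J.card) by ring] at h
    refine h.trans (ENNReal.ofReal_le_ofReal ?_)
    have hs : Real.sqrt 2 ≤ (p : ℝ) ^ (1 / 2 : ℝ) := by
      rw [← Real.sqrt_eq_rpow]
      exact Real.sqrt_le_sqrt hp2
    calc Real.exp (-((c + 3 / 2) * Real.log p * J.card)) * Real.sqrt 2 ^ Module.finrank ℝ (V J)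
        ≤ Real.exp (-((c + 3 / 2) * Real.log p * J.card)) * ((p : ℝ) ^ (1 / 2 : ℝ)) ^ J.card := by
          gcongr
          exact (pow_le_pow_right₀ (by rw [Real.one_le_sqrt]; norm_num) (hV J)).trans
            (pow_le_pow_left₀ (Real.sqrt_nonneg _) hs _)
      _ = a ^ J.card := by
          rw [ha, Real.rpow_def_of_pos hp0, Real.rpow_def_of_pos hp0, ← Real.exp_nat_mul,
            ← Real.exp_nat_mul, ← Real.exp_add]
          congr 1
          ring
  have hsum : ∑ J ∈ (univ : Finset (Finset (Fin p))).erase ∅, a ^ J.card ≤ 2 * (p : ℝ) ^ (-c) := by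
    have h1 := Fintype.sum_pow_mul_eq_add_pow (Fin p) a 1
    simp only [one_pow, mul_one, Fintype.card_fin] at h1
    rw [← Finset.add_sum_erase _ _ (mem_univ (∅ : Finset (Fin p)))] at h1
    have h2 : (a + 1) ^ p ≤ Real.exp (p * a) := by
      rw [Real.exp_nat_mul]
      exact pow_le_pow_left₀ (by positivity) (Real.add_one_le_exp a) p
    have h3 : |p * a| ≤ 1 := by
      rw [abs_of_nonneg (by positivity), hpa]
      exact Real.rpow_le_one_of_one_le_of_nonpos (by linarith) (by linarith)
    have h4 := (le_abs_self _).trans (Real.abs_exp_sub_one_le h3)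
    rw [abs_of_nonneg (by positivity), hpa] at h4
    rw [hpa] at h2
    simp only [card_empty, pow_zero] at h1
    linarith
  calc _ ≤ (Measure.pi fun _ : κ => gaussianReal 0 v)
        (⋃ J ∈ (univ : Finset (Finset (Fin p))).erase ∅,
          {z | v * ((4 * c + 6) * Real.log p * J.card)
            < ‖(V J).starProjection (WithLp.toLp 2 z)‖ ^ 2}) := by
        refine measure_mono ?_
        rintro z ⟨J, hJ⟩
        simp only [Set.mem_iUnion]
        refine ⟨J, ?_, hJ⟩
        rw [mem_erase]
        refine ⟨?_, mem_univ _⟩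
        rintro rfl
        have h0 := hV ∅
        rw [card_empty, Nat.le_zero, Submodule.finrank_eq_zero] at h0
        simp [h0] at hJ
    _ ≤ ∑ J ∈ (univ : Finset (Finset (Fin p))).erase ∅, ENNReal.ofReal (a ^ J.card) :=
        (measure_biUnion_finset_le _ _).trans (Finset.sum_le_sum fun J _ => hone J)
    _ ≤ _ := by
        rw [← ENNReal.ofReal_sum_of_nonneg fun J _ => by positivity]
        exact ENNReal.ofReal_le_ofReal hsum

/-- Prediction error of a projection estimator in terms of the excess residual over a subspace
containing the signal. -/
theorem norm_sq_starProjection_sub_le {E : Type*} [NormedAddCommGroup E] [InnerProductSpace ℝ E]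
    [FiniteDimensional ℝ E] {U V W : Submodule ℝ E} (hU : U ≤ W) (hV : V ≤ W) {m y z : E}
    (hm : m ∈ V) (hy : y = m + z) :
    0 ≤ ‖y - U.starProjection y‖ ^ 2 - ‖y - V.starProjection y‖ ^ 2 + ‖W.starProjection z‖ ^ 2 ∧
    ‖U.starProjection y - m‖ ^ 2 ≤ 2 * (‖y - U.starProjection y‖ ^ 2
      - ‖y - V.starProjection y‖ ^ 2) + 4 * ‖W.starProjection z‖ ^ 2 := by
  have hWy : W.starProjection y = m + W.starProjection z := by
    rw [hy, map_add, Submodule.starProjection_eq_self_iff.2 (hV hm)]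
  have hVy : y - V.starProjection y = z - V.starProjection z := by
    rw [hy, map_add, Submodule.starProjection_eq_self_iff.2 hm]
    abel
  have pyth : ∀ (S : Submodule ℝ E) (x w : E), w ∈ S →
      ‖x - w‖ ^ 2 = ‖x - S.starProjection x‖ ^ 2 + ‖S.starProjection x - w‖ ^ 2 := by
    intro S x w hw
    have h := S.starProjection_inner_eq_zero x (S.starProjection x - w)
      (S.sub_mem (S.starProjection_apply_mem x) hw)
    have h2 := norm_add_sq_real (x - S.starProjection x) (S.starProjection x - w)
    rw [h, sub_add_sub_cancel] at h2
    linarith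
  have h1 := pyth W y (U.starProjection y) (hU (U.starProjection_apply_mem y))
  have h2 := pyth W z 0 W.zero_mem
  have h3 := pyth V z 0 V.zero_mem
  rw [show y - W.starProjection y = z - W.starProjection z by rw [hWy, hy]; abel] at h1
  rw [← hVy] at h3
  simp only [sub_zero] at h2 h3
  have h4 : ‖U.starProjection y - m‖ ^ 2
      ≤ 2 * ‖W.starProjection y - U.starProjection y‖ ^ 2 + 2 * ‖W.starProjection z‖ ^ 2 := by
    have h5 : U.starProjection y - m
        = W.starProjection z - (W.starProjection y - U.starProjection y) := by
      rw [hWy]; abel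
    have h6 := parallelogram_law_with_norm ℝ (W.starProjection z)
      (W.starProjection y - U.starProjection y)
    rw [h5]
    nlinarith [mul_self_nonneg ‖W.starProjection z + (W.starProjection y - U.starProjection y)‖]
  constructor
  · nlinarith [sq_nonneg ‖W.starProjection y - U.starProjection y‖,
      sq_nonneg ‖V.starProjection z‖]
  · nlinarith [sq_nonneg ‖V.starProjection z‖]

/-- The span of the columns of `X` indexed by `J`. -/
noncomputable def colSpan {n p : ℕ} (X : Matrix (Fin n) (Fin p) ℝ) (J : Finset (Fin p)) :
    Submodule ℝ (EuclideanSpace ℝ (Fin n)) :=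
  Submodule.span ℝ ((J.image fun j => WithLp.toLp 2 (X.col j) : Finset _) : Set _)

theorem colSpan_mono {n p : ℕ} (X : Matrix (Fin n) (Fin p) ℝ) {J K : Finset (Fin p)}
    (h : J ⊆ K) : colSpan X J ≤ colSpan X K :=
  Submodule.span_mono (by exact_mod_cast Finset.image_subset_image h)

theorem finrank_colSpan_le {n p : ℕ} (X : Matrix (Fin n) (Fin p) ℝ) (J : Finset (Fin p)) :
    Module.finrank ℝ (colSpan X J) ≤ J.card :=
  (finrank_span_finset_le_card _).trans Finset.card_image_le

theorem toLp_mulVec_mem_colSpan {n p : ℕ} (X : Matrix (Fin n) (Fin p) ℝ) {J : Finset (Fin p)}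
    {b : Fin p → ℝ} (hb : ∀ j ∉ J, b j = 0) : WithLp.toLp 2 (X.mulVec b) ∈ colSpan X J := by
  have h : WithLp.toLp 2 (X.mulVec b) = ∑ j, b j • WithLp.toLp 2 (X.col j) := by
    ext i
    simp [Matrix.mulVec, dotProduct, mul_comm]
  rw [h]
  refine Submodule.sum_mem _ fun j _ => ?_
  by_cases hj : j ∈ J
  · exact Submodule.smul_mem _ _ (Submodule.subset_span (by
      simpa using ⟨j, hj, rfl⟩))
  · simp [hb j hj]

/-- The normal equations characterize the orthogonal projection onto a column span. -/
theorem starProjection_colSpan_eq {n p : ℕ} (X : Matrix (Fin n) (Fin p) ℝ) {J : Finset (Fin p)}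
    {b : Fin p → ℝ} (hb : ∀ j ∉ J, b j = 0) {v : Fin n → ℝ}
    (hv : ∀ j ∈ J, ∑ i, (v i - X.mulVec b i) * X i j = 0) :
    (colSpan X J).starProjection (WithLp.toLp 2 v) = WithLp.toLp 2 (X.mulVec b) := by
  refine Submodule.eq_starProjection_of_mem_of_inner_eq_zero (toLp_mulVec_mem_colSpan X hb) ?_
  intro w hw
  induction hw using Submodule.span_induction with
  | mem x hx =>
    obtain ⟨j, hj, rfl⟩ : ∃ j ∈ J, WithLp.toLp 2 (X.col j) = x := by simpa using hx
    rw [← hv j hj]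
    simp [PiLp.inner_apply, mul_comm]
  | zero => simp
  | add x y _ _ hx hy => rw [inner_add_right, hx, hy, add_zero]
  | smul a x _ hx => rw [inner_smul_right, hx, mul_zero]

/-- Comparing the log-weights of two sub-models of sizes `s` and `t` with residuals `R` and `S`. -/
theorem residual_sub_le_of_weight_le {p s t : ℕ} (hp : 0 < p) {lam v R S : ℝ} (hv : 0 < v)
    (h : ((p.choose t : ℝ))⁻¹ * Real.exp (-(lam * t)) * Real.exp (-S / (2 * v))
      ≤ ((p.choose s : ℝ))⁻¹ * Real.exp (-(lam * s)) * Real.exp (-R / (2 * v)))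
    (ht : t ≤ p) :
    R - S ≤ v * (2 * lam * (t - s) + 2 * t * Real.log p) := by
  have hp' : (0 : ℝ) < p := by exact_mod_cast hp
  have h1 : Real.exp (-(t * Real.log p)) ≤ ((p.choose t : ℝ))⁻¹ := by
    rw [Real.exp_neg, Real.exp_nat_mul, Real.exp_log hp']
    refine inv_anti₀ (by exact_mod_cast Nat.choose_pos ht) ?_
    exact_mod_cast Nat.choose_le_pow p t
  have h2 : ((p.choose s : ℝ))⁻¹ ≤ 1 := Nat.cast_inv_le_one _
  have h3 : Real.exp (-(t * Real.log p)) * Real.exp (-(lam * t)) * Real.exp (-S / (2 * v))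
      ≤ 1 * Real.exp (-(lam * s)) * Real.exp (-R / (2 * v)) := by
    refine le_trans (by gcongr) (h.trans (by gcongr))
  rw [one_mul, ← Real.exp_add, ← Real.exp_add, ← Real.exp_add, Real.exp_le_exp] at h3
  have h4 : (R - S) / (2 * v) ≤ lam * (t - s) + t * Real.log p := by
    rw [sub_div]
    rw [neg_div, neg_div] at h3
    linarith
  rw [div_le_iff₀ (by positivity)] at h4
  linarith

/-- The arithmetic behind the choice of the penalty level: a sub-model whose penalized excess
residual is nonnegative is not much larger than the true one, and its prediction error is small. -/
theorem card_le_and_error_le_of_penalty {s t v L ε c lam D T e : ℝ} (hs : 0 ≤ s) (ht : 0 ≤ t)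
    (hv : 0 < v) (hL : 0 < L) (hε : 0 < ε) (hε2 : ε ≤ 1 / 2) (hc : 1 ≤ c)
    (hlam : lam = ((1 + ε) / ε) * (23 + 5 * c) * L)
    (hD : D ≤ v * (2 * lam * (t - s) + 2 * t * L)) (hT : T ≤ v * ((4 * c + 6) * L * (s + t)))
    (h0 : 0 ≤ D + T) (he : e ≤ 2 * D + 4 * T) :
    s ≤ (1 + ε) * t ∧ e ≤ v * (8 * t * lam) := by
  have hel : ε * lam = (1 + ε) * (23 + 5 * c) * L := by
    rw [hlam]; field_simp
  have hl3 : 3 * (23 + 5 * c) * L ≤ lam := by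
    rw [hlam]
    gcongr
    rw [le_div_iff₀ hε]
    linarith
  have hcL : L ≤ c * L := by nlinarith
  have h1 : 0 ≤ 2 * lam * (t - s) + 2 * t * L + (4 * c + 6) * L * (s + t) := by
    have : 0 ≤ v * (2 * lam * (t - s) + 2 * t * L + (4 * c + 6) * L * (s + t)) := by linarith
    exact nonneg_of_mul_nonneg_right this hv
  constructor
  · by_contra! hlt
    have hpos : 0 < 2 * lam - (4 * c + 6) * L := by nlinarith
    have h2 := mul_lt_mul_of_pos_right hlt hpos
    have h3 : t * (2 * lam + 2 * L + (4 * c + 6) * L)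
        ≤ t * ((1 + ε) * (2 * lam - (4 * c + 6) * L)) := by
      refine mul_le_mul_of_nonneg_left ?_ ht
      have h5 : (1 + ε) * (2 * lam - (4 * c + 6) * L)
          = 2 * lam + 2 * (ε * lam) - (1 + ε) * ((4 * c + 6) * L) := by ring
      rw [h5, hel]
      have h6 : 0 ≤ ε * (c * L) := by positivity
      have h7 : 0 ≤ ε * L := by positivity
      nlinarith
    nlinarith
  · have h2 : s * ((4 * c + 6) * L - lam) ≤ 0 :=
      mul_nonpos_of_nonneg_of_nonpos hs (by nlinarith)
    have h3 : 0 ≤ t * (lam - (4 * c + 7) * L) := mul_nonneg ht (by nlinarith)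
    have h4 : e ≤ v * (4 * lam * (t - s) + 4 * t * L + 4 * ((4 * c + 6) * L * (s + t))) := by
      linarith
    refine h4.trans (mul_le_mul_of_nonneg_left ?_ hv.le)
    nlinarith

theorem stmt6
    (n p : ℕ) (hn : 1 ≤ n) (hnp : n ≤ p) (hp2 : 2 ≤ p)
    (X : Matrix (Fin n) (Fin p) ℝ)
    (hX : ∀ j, Real.sqrt (∑ i, (X i j)^2) = Real.sqrt n)
    (σ : ℝ) (hσ : 0 < σ)
    (βs : Fin p → ℝ) (sstar : ℕ) (hs1 : 1 ≤ sstar)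
    (Jstar : Finset (Fin p)) (hJstar : Jstar = Finset.univ.filter (fun j => βs j ≠ 0))
    (hcard : Jstar.card = sstar)
    (P : Finset (Fin p) → (Fin n → ℝ) → (Fin n → ℝ))
    (hP : ∀ (J : Finset (Fin p)) (v : Fin n → ℝ),
        (∃ cf : Fin p → ℝ, (∀ j ∉ J, cf j = 0) ∧ P J v = X.mulVec cf)
        ∧ ∀ j ∈ J, (∑ i, (v i - P J v i) * X i j) = 0)
    (μ : Measure (Fin n → ℝ))
    (hμ : μ = Measure.pi (fun _ : Fin n => gaussianReal 0 (Real.toNNReal (σ^2))))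
    (hminimal : ∀ b : Fin p → ℝ, X.mulVec b = X.mulVec βs →
        sstar ≤ (Finset.univ.filter (fun j => b j ≠ 0)).card)
    (y : (Fin n → ℝ) → Fin n → ℝ)
    (hy : ∀ z i, y z i = X.mulVec βs i + z i)
    (sbar : ℕ) (hsbar1 : sstar ≤ sbar) (hsbar2 : sbar ≤ p)
    (lam : ℝ)
    (w Post : (Fin n → ℝ) → Finset (Fin p) → ℝ)
    (hw : ∀ z J, w z J = if J.card ≤ sbar then
        ((p.choose J.card : ℝ))⁻¹ * Real.exp (-(lam * (J.card : ℝ)))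
          * Real.exp (-(∑ i, (y z i - P J (y z) i)^2) / (2 * σ^2)) else 0)
    (hPost : ∀ z J, Post z J = w z J / ∑ J' : Finset (Fin p), w z J')
    (bh : (Fin n → ℝ) → Finset (Fin p) → Fin p → ℝ)
    (hbh : ∀ z J, (∀ j ∉ J, bh z J j = 0)
        ∧ X.mulVec (bh z J) = P J (y z)
        ∧ ∀ b : Fin p → ℝ, (∀ j ∉ J, b j = 0) → X.mulVec b = P J (y z) →
            ∑ j, (bh z J j)^2 ≤ ∑ j, (b j)^2)
    (nu : ℝ → ℝ)
    (hnu : ∀ s : ℝ, nu s = sInf {r : ℝ | ∃ (J : Finset (Fin p)) (u : Fin p → ℝ),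
        (J.card : ℝ) ≤ s ∧ (∀ j ∉ J, u j = 0) ∧ (∑ j, (u j)^2) = 1 ∧
        r = Real.sqrt (∑ i, (X.mulVec u i)^2) / Real.sqrt n})
    (ε c : ℝ) (hε : 0 < ε) (hε2 : ε ≤ 1/2) (hc : 1 ≤ c)
    (hI : 0 < nu ((2 + ε) * (sstar : ℝ)))
    (hlam : lam = ((1 + ε) / ε) * (23 + 5 * c) * Real.log p)
    :
    ENNReal.ofReal (1 - 3 * (p : ℝ) ^ (-c)) ≤
      μ {z | ∀ Jh : Finset (Fin p), (∀ J' : Finset (Fin p), Post z J' ≤ Post z Jh) →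
        Real.sqrt (∑ j, (bh z Jh j - βs j)^2)
          ≤ σ * Real.sqrt (8 * (sstar : ℝ) * lam
              / ((n : ℝ) * (nu ((2 + ε) * (sstar : ℝ)))^2))} := by
  
  have hp0 : 0 < p := by omega
  have hn0 : (0 : ℝ) < n := by exact_mod_cast hn
  have hL : 0 < Real.log p := Real.log_pos (by exact_mod_cast hp2)
  set v : NNReal := Real.toNNReal (σ ^ 2) with hvdef
  have hvσ : (v : ℝ) = σ ^ 2 := Real.coe_toNNReal _ (by positivity)
  have hv : v ≠ 0 := by
    intro h
    rw [h] at hvσ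
    exact absurd hvσ.symm (by positivity)
  have hv0 : (0 : ℝ) < v := by positivity
  have hβ : ∀ j ∉ Jstar, βs j = 0 := by
    intro j hj
    simpa [hJstar] using hj
  have norm_sq : ∀ x : Fin n → ℝ, ‖WithLp.toLp 2 x‖ ^ 2 = ∑ i, x i ^ 2 := fun x =>
    EuclideanSpace.real_norm_sq_eq _
  have hproj : ∀ J x, (colSpan X J).starProjection (WithLp.toLp 2 x) = WithLp.toLp 2 (P J x) := by
    intro J x
    obtain ⟨⟨b, hb, hPb⟩, horth⟩ := hP J x
    rw [hPb] at horth ⊢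
    exact starProjection_colSpan_eq X hb horth
  have hnu_le : ∀ (J : Finset (Fin p)) (u : Fin p → ℝ), (J.card : ℝ) ≤ (2 + ε) * sstar →
      (∀ j ∉ J, u j = 0) →
      n * nu ((2 + ε) * sstar) ^ 2 * ∑ j, u j ^ 2 ≤ ∑ i, X.mulVec u i ^ 2 := by
    intro J u hJ hu
    set D := ∑ j, u j ^ 2 with hD
    have hD0 : 0 ≤ D := Finset.sum_nonneg fun _ _ => sq_nonneg _
    rcases hD0.eq_or_lt with h0 | hpos
    · rw [← h0, mul_zero]
      exact Finset.sum_nonneg fun _ _ => sq_nonneg _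
    have hr : nu ((2 + ε) * sstar)
        ≤ Real.sqrt (∑ i, X.mulVec ((Real.sqrt D)⁻¹ • u) i ^ 2) / Real.sqrt n := by
      rw [hnu]
      refine csInf_le ⟨0, ?_⟩ ⟨J, (Real.sqrt D)⁻¹ • u, hJ, fun j hj => by simp [hu j hj], ?_, rfl⟩
      · rintro r ⟨_, _, _, _, _, rfl⟩
        positivity
      · simp only [Pi.smul_apply, smul_eq_mul, mul_pow, ← Finset.mul_sum, inv_pow,
          Real.sq_sqrt hD0, ← hD]
        exact inv_mul_cancel₀ hpos.ne'
    have hr2 := pow_le_pow_left₀ hI.le hr 2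
    rw [div_pow, Real.sq_sqrt (Finset.sum_nonneg fun _ _ => sq_nonneg _), Real.sq_sqrt hn0.le]
      at hr2
    simp only [Matrix.mulVec_smul, Pi.smul_apply, smul_eq_mul, mul_pow, ← Finset.mul_sum, inv_pow,
      Real.sq_sqrt hD0] at hr2
    rw [le_div_iff₀ hn0, inv_mul_eq_div, le_div_iff₀ hpos] at hr2
    linarith
  have hwpos : ∀ z, 0 < ∑ J', w z J' := by
    intro z
    refine Finset.sum_pos' (fun J _ => ?_) ⟨∅, mem_univ _, ?_⟩
    · rw [hw]; positivity
    · rw [hw, if_pos (by simp)]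
      simp only [card_empty, Nat.choose_zero_right]
      positivity
  have key : ∀ z, (∀ J, ‖(colSpan X J).starProjection (WithLp.toLp 2 z)‖ ^ 2
        ≤ v * ((4 * c + 6) * Real.log p * J.card)) →
      ∀ Jh : Finset (Fin p), (∀ J' : Finset (Fin p), Post z J' ≤ Post z Jh) →
        Real.sqrt (∑ j, (bh z Jh j - βs j)^2)
          ≤ σ * Real.sqrt (8 * (sstar : ℝ) * lam
              / ((n : ℝ) * (nu ((2 + ε) * (sstar : ℝ)))^2)) := by
    intro z hz Jh hJh
    have hcard_union : ((Jh ∪ Jstar).card : ℝ) ≤ Jh.card + sstar := by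
      rw [← hcard]
      exact_mod_cast Finset.card_union_le _ _
    have hww := hJh Jstar
    rw [hPost, hPost, div_le_div_iff_of_pos_right (hwpos z), hw z Jstar, hw z Jh,
      if_pos (by omega)] at hww
    have hJsbar : Jh.card ≤ sbar := by
      by_contra hgt
      rw [if_neg hgt, hcard] at hww
      have := Nat.choose_pos (hsbar1.trans hsbar2)
      exact absurd hww (not_le.2 (by positivity))
    rw [if_pos hJsbar, hcard, ← hvσ] at hww
    have hD := residual_sub_le_of_weight_le hp0 hv0 hww (hsbar1.trans hsbar2)
    have hyz : WithLp.toLp 2 (y z) = WithLp.toLp 2 (X.mulVec βs) + WithLp.toLp 2 z := by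
      rw [← WithLp.toLp_add]
      congr 1
      exact funext (hy z)
    obtain ⟨h0, he⟩ := norm_sq_starProjection_sub_le
      (colSpan_mono X (Finset.subset_union_left : Jh ⊆ Jh ∪ Jstar))
      (colSpan_mono X (Finset.subset_union_right : Jstar ⊆ Jh ∪ Jstar))
      (toLp_mulVec_mem_colSpan X hβ) hyz
    have hres : ∀ J, ‖WithLp.toLp 2 (y z) - (colSpan X J).starProjection (WithLp.toLp 2 (y z))‖ ^ 2
        = ∑ i, (y z i - P J (y z) i) ^ 2 := by
      intro J
      rw [hproj, ← WithLp.toLp_sub, norm_sq]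
      simp
    have hpred : ‖(colSpan X Jh).starProjection (WithLp.toLp 2 (y z))
        - WithLp.toLp 2 (X.mulVec βs)‖ ^ 2 = ∑ i, X.mulVec (bh z Jh - βs) i ^ 2 := by
      rw [hproj, ← (hbh z Jh).2.1, ← WithLp.toLp_sub, ← Matrix.mulVec_sub, norm_sq]
    rw [hres, hres] at h0 he
    rw [hpred] at he
    have hT := (hz (Jh ∪ Jstar)).trans (mul_le_mul_of_nonneg_left
      (mul_le_mul_of_nonneg_left hcard_union (by positivity)) hv0.le)
    obtain ⟨hcard_le, herr⟩ := card_le_and_error_le_of_penalty (Nat.cast_nonneg _)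
      (Nat.cast_nonneg _) hv0 hL hε hε2 hc hlam hD hT h0 he
    have hrestricted := (hnu_le (Jh ∪ Jstar) (bh z Jh - βs) (by linarith) (fun j hj => by
      rw [Finset.mem_union, not_or] at hj
      simp [(hbh z Jh).1 j hj.1, hβ j hj.2])).trans herr
    rw [Real.sqrt_le_left (by positivity), mul_pow, Real.sq_sqrt, mul_div_assoc',
      le_div_iff₀ (by positivity), ← hvσ, mul_comm]
    · simpa using hrestricted
    · have : 0 < lam := by rw [hlam]; positivity
      positivity
  have hbad := measure_exists_lt_norm_sq_starProjection_le hv hp2 (colSpan X)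
    (finrank_colSpan_le X) (by linarith : (0 : ℝ) ≤ c)
  rw [← hμ] at hbad
  have : IsProbabilityMeasure μ := by rw [hμ]; infer_instance
  have hrp : (0 : ℝ) ≤ (p : ℝ) ^ (-c) := by positivity
  rw [ENNReal.ofReal_sub _ (by positivity), ENNReal.ofReal_one, tsub_le_iff_right,
    ← measure_univ (μ := μ)]
  refine (measure_mono fun z _ => ?_).trans ((measure_union_le _ _).trans
    (add_le_add_right (hbad.trans (ENNReal.ofReal_le_ofReal (by linarith))) _))
  by_cases h : ∀ J, ‖(colSpan X J).starProjection (WithLp.toLp 2 z)‖ ^ 2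
        ≤ v * ((4 * c + 6) * Real.log p * J.card)
  · exact Or.inl (key z h)
  · push Not at h
    exact Or.inr h
end
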